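/- Let G be a connected graph of order n with diameter d ≥ 2 and G ≠ P_{d+1}. Then m_G[n−d+2, n] = n−d if and only if either (i) G ≅ G_{n,d,t} for some t with 2 ≤ t ≤ ⌊d/2⌋+1, or (ii) G ≅ G_{n,d,r,a} for some r, a with 2 ≤ r ≤ ⌊(d+1)/2⌋ and 1 ≤ a ≤ n−d−2. -/

import Mathlib

open Matrix

/-- Sorted (nonincreasing) list of eigenvalues of a matrix, empty if not Hermitian. -/
noncomputable def heigList {𝕜 : Type} [RCLike 𝕜] {m : Type} [Fintype m] [DecidableEq m]
    (M : Matrix m m 𝕜) : List ℝ :=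
  if h : M.IsHermitian then (Finset.univ.val.map h.eigenvalues).sort (· ≥ ·) else []

/-- `kthEig M k` is the k-th largest eigenvalue of `M` (1-indexed). -/
noncomputable def kthEig {𝕜 : Type} [RCLike 𝕜] {m : Type} [Fintype m] [DecidableEq m]
    (M : Matrix m m 𝕜) (k : ℕ) : ℝ :=
  (heigList M).getD (k - 1) 0

/-- Laplacian matrix of a simple graph on a finite vertex type, over ℝ. -/
noncomputable def lapMat {V : Type} [Fintype V] [DecidableEq V] (G : SimpleGraph V) :
    Matrix V V ℝ :=
  letI := Classical.decRel G.Adj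
  G.lapMatrix ℝ

/-- `lapμ G k` is the k-th largest Laplacian eigenvalue of `G` (1-indexed). -/
noncomputable def lapμ {V : Type} [Fintype V] [DecidableEq V] (G : SimpleGraph V) (k : ℕ) : ℝ :=
  kthEig (lapMat G) k

/-- Number of Laplacian eigenvalues of `G` in the closed interval `[a, b]`, with multiplicity. -/
noncomputable def mIcc {V : Type} [Fintype V] [DecidableEq V] (G : SimpleGraph V) (a b : ℝ) : ℕ :=
  ((heigList (lapMat G)).filter (fun x => a ≤ x ∧ x ≤ b)).length

/-- The graph `G_{n,d,t}`: a path `v₁ … v_{d+1}` (vertices `0, …, d`) together with a clique on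
vertices `d+1, …, n-1`, each clique vertex joined to `v_{t-1}, v_t, v_{t+1}`
(vertices `t-2, t-1, t`). -/
def Gndt (n d t : ℕ) : SimpleGraph (Fin n) :=
  SimpleGraph.fromRel (fun i j =>
    (i.val + 1 = j.val ∧ j.val ≤ d) ∨
    (d + 1 ≤ i.val ∧ d + 1 ≤ j.val) ∨
    (d + 1 ≤ i.val ∧ (j.val = t - 2 ∨ j.val = t - 1 ∨ j.val = t)))

/-- The graph `G_{n,d,r,a}`: a path `v₁ … v_{d+1}` (vertices `0, …, d`) together with a clique on
vertices `d+1, …, n-1`, all clique vertices joined to `v_r, v_{r+1}` (vertices `r-1, r`), the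
first `a` clique vertices joined to `v_{r-1}` (vertex `r-2`), and the remaining ones joined to
`v_{r+2}` (vertex `r+1`). -/
def Gndra (n d r a : ℕ) : SimpleGraph (Fin n) :=
  SimpleGraph.fromRel (fun i j =>
    (i.val + 1 = j.val ∧ j.val ≤ d) ∨
    (d + 1 ≤ i.val ∧ d + 1 ≤ j.val) ∨
    (d + 1 ≤ i.val ∧ (j.val = r - 1 ∨ j.val = r)) ∨
    (d + 1 ≤ i.val ∧ i.val ≤ d + a ∧ j.val = r - 2) ∨
    (d + a + 1 ≤ i.val ∧ j.val = r + 1))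


/-! ### Quadratic form and eigenvalue counting -/

/-- Twice the Laplacian quadratic form. -/
noncomputable def qf {V : Type} [Fintype V] (G : SimpleGraph V) (x : V → ℝ) : ℝ :=
  letI := Classical.decRel G.Adj
  ∑ v, ∑ w, if G.Adj v w then (x v - x w) ^ 2 else 0

lemma lapMat_herm {V : Type} [Fintype V] [DecidableEq V] (G : SimpleGraph V) :
    (lapMat G).IsHermitian := by
  let _ := Classical.decRel G.Adj
  exact G.isHermitian_lapMatrix ℝ

lemma lap_form {V : Type} [Fintype V] [DecidableEq V] (G : SimpleGraph V) (x : V → ℝ) :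
    x ⬝ᵥ (lapMat G *ᵥ x) = qf G x / 2 := by
  let _ := Classical.decRel G.Adj
  have := G.lapMatrix_toLinearMap₂' ℝ x
  rw [Matrix.toLinearMap₂'_apply'] at this
  exact this

lemma herm_decomp {V : Type} [Fintype V] [DecidableEq V] {A : Matrix V V ℝ} (hA : A.IsHermitian) :
    ∃ M : Matrix V V ℝ, (∀ x : V → ℝ, ∑ i, (Mᵀ *ᵥ x) i ^ 2 = ∑ v, x v ^ 2) ∧
      (∀ x : V → ℝ, x ⬝ᵥ (A *ᵥ x) = ∑ i, hA.eigenvalues i * (Mᵀ *ᵥ x) i ^ 2) := by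
  let M : Matrix V V ℝ := hA.eigenvectorUnitary
  have h1 : M * Mᵀ = 1 := by
    have := Unitary.coe_mul_star_self hA.eigenvectorUnitary
    rwa [Unitary.coe_star, Matrix.star_eq_conjTranspose,
      Matrix.conjTranspose_eq_transpose_of_trivial] at this
  have h2 : A = M * diagonal hA.eigenvalues * Mᵀ := by
    have := hA.spectral_theorem
    rw [Unitary.conjStarAlgAut_apply, Matrix.star_eq_conjTranspose,
      Matrix.conjTranspose_eq_transpose_of_trivial] at this
    exact this
  refine ⟨M, fun x => ?_, fun x => ?_⟩
  · have : (Mᵀ *ᵥ x) ⬝ᵥ (Mᵀ *ᵥ x) = x ⬝ᵥ x := by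
      rw [Matrix.dotProduct_mulVec, Matrix.vecMul_transpose, Matrix.mulVec_mulVec, h1,
        Matrix.one_mulVec]
    simpa [dotProduct, sq] using this
  · conv_lhs => rw [h2]
    rw [← Matrix.mulVec_mulVec, ← Matrix.mulVec_mulVec, Matrix.dotProduct_mulVec,
      ← Matrix.mulVec_transpose]
    simp only [dotProduct, Matrix.mulVec_diagonal]
    refine Finset.sum_congr rfl fun i _ => by ring

lemma exists_ker {V κ : Type} [Fintype V] [Fintype κ] (f : (V → ℝ) →ₗ[ℝ] (κ → ℝ))
    (h : Fintype.card κ < Fintype.card V) : ∃ x, x ≠ 0 ∧ f x = 0 := by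
  have := LinearMap.ker_ne_bot_of_finrank_lt (f := f) (by simpa using h)
  obtain ⟨x, hx, hx0⟩ := (Submodule.ne_bot_iff _).1 this
  exact ⟨x, hx0, hx⟩

/-- The number of Laplacian eigenvalues at least `c`. -/
noncomputable def cnt {V : Type} [Fintype V] [DecidableEq V] (G : SimpleGraph V) (c : ℝ) : ℕ :=
  Fintype.card {i // c ≤ (lapMat_herm G).eigenvalues i}

lemma cnt_le {V κ : Type} [Fintype V] [DecidableEq V] [Fintype κ] (G : SimpleGraph V) (c : ℝ)
    (f : (V → ℝ) →ₗ[ℝ] (κ → ℝ))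
    (h : ∀ x, f x = 0 → 2 * c * ∑ v, x v ^ 2 ≤ qf G x → x = 0) :
    cnt G c ≤ Fintype.card κ := by
  by_contra hcon
  push Not at hcon
  unfold cnt at hcon
  obtain ⟨M, hM1, hM2⟩ := herm_decomp (lapMat_herm G)
  set lam := (lapMat_herm G).eigenvalues with hlam
  let g : (V → ℝ) →ₗ[ℝ] ({i // ¬ c ≤ lam i} → ℝ) :=
    LinearMap.pi fun i => (LinearMap.proj i.1).comp (Mᵀ).mulVecLin
  let F : (V → ℝ) →ₗ[ℝ] (κ ⊕ {i // ¬ c ≤ lam i} → ℝ) :=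
    LinearMap.pi (Sum.elim (fun k => (LinearMap.proj k).comp f)
      (fun i => (LinearMap.proj i).comp g))
  obtain ⟨x, hx0, hx⟩ := exists_ker F (by
    have := Fintype.card_subtype_compl (fun i => c ≤ lam i)
    have h3 := Fintype.card_subtype_le (fun i => c ≤ lam i)
    rw [Fintype.card_sum]
    lia)
  apply hx0
  apply h x
  · ext k
    exact congrFun hx (Sum.inl k)
  · have h2 := lap_form G x
    rw [hM2] at h2
    have : ∑ v, c * (Mᵀ *ᵥ x) v ^ 2 ≤ ∑ i, lam i * (Mᵀ *ᵥ x) i ^ 2 := by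
      refine Finset.sum_le_sum fun i _ => ?_
      by_cases hi : c ≤ lam i
      · exact mul_le_mul_of_nonneg_right hi (sq_nonneg _)
      · have : (Mᵀ *ᵥ x) i = 0 := congrFun hx (Sum.inr ⟨i, hi⟩)
        simp [this]
    rw [← Finset.mul_sum, hM1] at this
    linarith

lemma cnt_ge {V κ : Type} [Fintype V] [DecidableEq V] [Fintype κ] (G : SimpleGraph V) (c : ℝ)
    (f : (V → ℝ) →ₗ[ℝ] (κ → ℝ))
    (h : ∀ x, f x = 0 → 2 * c * ∑ v, x v ^ 2 ≤ qf G x) :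
    Fintype.card V ≤ cnt G c + Fintype.card κ := by
  by_contra hcon
  push Not at hcon
  unfold cnt at hcon
  obtain ⟨M, hM1, hM2⟩ := herm_decomp (lapMat_herm G)
  set lam := (lapMat_herm G).eigenvalues with hlam
  let g : (V → ℝ) →ₗ[ℝ] ({i // c ≤ lam i} → ℝ) :=
    LinearMap.pi fun i => (LinearMap.proj i.1).comp (Mᵀ).mulVecLin
  let F : (V → ℝ) →ₗ[ℝ] (κ ⊕ {i // c ≤ lam i} → ℝ) :=
    LinearMap.pi (Sum.elim (fun k => (LinearMap.proj k).comp f)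
      (fun i => (LinearMap.proj i).comp g))
  obtain ⟨x, hx0, hx⟩ := exists_ker F (by
    rw [Fintype.card_sum]
    lia)
  have hc := h x (by
    ext k
    exact congrFun hx (Sum.inl k))
  have h2 := lap_form G x
  rw [hM2] at h2
  obtain ⟨v, hv⟩ := Function.ne_iff.1 hx0
  have hpos : 0 < ∑ v, x v ^ 2 :=
    Finset.sum_pos' (fun i _ => sq_nonneg _) ⟨v, Finset.mem_univ _, by
      have : x v ≠ 0 := hv
      positivity⟩
  have hz : ∀ i, c ≤ lam i → (Mᵀ *ᵥ x) i = 0 := fun i hi => congrFun hx (Sum.inr ⟨i, hi⟩)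
  have : ∑ i, lam i * (Mᵀ *ᵥ x) i ^ 2 < ∑ v, c * (Mᵀ *ᵥ x) v ^ 2 := by
    rw [← hM1] at hpos
    obtain ⟨i, _, hi⟩ := Finset.exists_ne_zero_of_sum_ne_zero hpos.ne'
    have hi' : ¬ c ≤ lam i := fun hh => hi (by rw [hz i hh]; ring)
    refine Finset.sum_lt_sum (fun j _ => ?_) ⟨i, Finset.mem_univ _, ?_⟩
    · by_cases hj : c ≤ lam j
      · simp [hz j hj]
      · exact mul_le_mul_of_nonneg_right (not_le.1 hj).le (sq_nonneg _)
    · exact mul_lt_mul_of_pos_right (not_le.1 hi') (lt_of_le_of_ne (sq_nonneg _) (Ne.symm hi))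
  rw [← Finset.mul_sum, hM1] at this
  linarith

lemma sum_sq_diff {V : Type} (S : Finset V) (x : V → ℝ) :
    ∑ v ∈ S, ∑ w ∈ S, (x v - x w) ^ 2 = 2 * S.card * ∑ v ∈ S, x v ^ 2 - 2 * (∑ v ∈ S, x v) ^ 2 := by
  have h : ∀ v w, (x v - x w) ^ 2 = x v ^ 2 + x w ^ 2 - 2 * (x v * x w) := fun v w => by ring
  simp only [h, Finset.sum_add_distrib, Finset.sum_sub_distrib, ← Finset.mul_sum, ← Finset.sum_mul,
    Finset.sum_const, nsmul_eq_mul]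
  ring

lemma qf_le {V : Type} [Fintype V] (G : SimpleGraph V) (x : V → ℝ) :
    qf G x ≤ 2 * Fintype.card V * ∑ v, x v ^ 2 := by
  have h1 : qf G x ≤ ∑ v, ∑ w, (x v - x w) ^ 2 := by
    unfold qf
    refine Finset.sum_le_sum fun v _ => Finset.sum_le_sum fun w _ => ?_
    split_ifs
    · exact le_rfl
    · positivity
  rw [sum_sq_diff, Finset.card_univ] at h1
  nlinarith [sq_nonneg (∑ v, x v)]

lemma eig_le {V : Type} [Fintype V] [DecidableEq V] (G : SimpleGraph V) (i : V) :
    (lapMat_herm G).eigenvalues i ≤ Fintype.card V := by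
  set e : V → ℝ := ⇑((lapMat_herm G).eigenvectorBasis i) with he
  have h1 : lapMat G *ᵥ e = (lapMat_herm G).eigenvalues i • e :=
    (lapMat_herm G).mulVec_eigenvectorBasis i
  have h2 := lap_form G e
  have hn : ∑ v, e v ^ 2 = 1 := by
    have := (lapMat_herm G).eigenvectorBasis.orthonormal.1 i
    have h3 := EuclideanSpace.real_norm_sq_eq ((lapMat_herm G).eigenvectorBasis i)
    rw [this] at h3
    simpa using h3.symm
  have h4 := qf_le G e
  rw [h1, dotProduct_smul] at h2
  have h5 : e ⬝ᵥ e = 1 := by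
    rw [← hn]
    simp [dotProduct, sq]
  rw [h5] at h2
  rw [hn] at h4
  simp only [smul_eq_mul, mul_one] at h2 h4
  linarith

lemma mIcc_eq {V : Type} [Fintype V] [DecidableEq V] (G : SimpleGraph V) (a : ℝ) :
    mIcc G a (Fintype.card V) = cnt G a := by
  unfold mIcc heigList cnt
  rw [dif_pos (lapMat_herm G), Fintype.card_subtype]
  rw [← Multiset.coe_card, ← Multiset.filter_coe, Multiset.sort_eq, Multiset.filter_map,
    Multiset.card_map]
  have : (Finset.univ.filter fun i => a ≤ (lapMat_herm G).eigenvalues i).card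
    = Multiset.card (Multiset.filter (fun i => a ≤ (lapMat_herm G).eigenvalues i)
      (Finset.univ : Finset V).val) := rfl
  rw [this]
  congr 1
  refine Multiset.filter_congr fun i _ => ?_
  simp [eig_le G i]

/-- Counting with vanishing outside `S` and further linear constraints: upper bound. -/
lemma cnt_le' {V : Type} [Fintype V] [DecidableEq V] (G : SimpleGraph V) (c : ℝ)
    (S : Finset V) {r : ℕ} (f : Fin r → ((V → ℝ) →ₗ[ℝ] ℝ))
    (h : ∀ x, (∀ v, v ∉ S → x v = 0) → (∀ k, f k x = 0) →
      2 * c * ∑ v, x v ^ 2 ≤ qf G x → x = 0) :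
    cnt G c + S.card ≤ Fintype.card V + r := by
  have := cnt_le G c (κ := {v // v ∉ S} ⊕ Fin r)
    (LinearMap.pi (Sum.elim (fun v => LinearMap.proj v.1) f)) (by
      intro x hx
      exact h x (fun v hv => congrFun hx (Sum.inl ⟨v, hv⟩)) (fun k => congrFun hx (Sum.inr k)))
  have h2 := Fintype.card_subtype_compl (fun v => v ∈ S)
  have h3 := Fintype.card_subtype_le (fun v => v ∈ S)
  rw [Fintype.card_sum, Fintype.card_fin] at this
  rw [Fintype.card_coe] at h2 h3
  omega

lemma cnt_ge' {V : Type} [Fintype V] [DecidableEq V] (G : SimpleGraph V) (c : ℝ)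
    (S : Finset V) {r : ℕ} (f : Fin r → ((V → ℝ) →ₗ[ℝ] ℝ))
    (h : ∀ x, (∀ v, v ∉ S → x v = 0) → (∀ k, f k x = 0) →
      2 * c * ∑ v, x v ^ 2 ≤ qf G x) :
    S.card ≤ cnt G c + r := by
  have := cnt_ge G c (κ := {v // v ∉ S} ⊕ Fin r)
    (LinearMap.pi (Sum.elim (fun v => LinearMap.proj v.1) f)) (by
      intro x hx
      exact h x (fun v hv => congrFun hx (Sum.inl ⟨v, hv⟩)) (fun k => congrFun hx (Sum.inr k)))
  have h2 := Fintype.card_subtype_compl (fun v => v ∈ S)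
  have h3 := Fintype.card_subtype_le (fun v => v ∈ S)
  rw [Fintype.card_sum, Fintype.card_fin] at this
  rw [Fintype.card_coe] at h2 h3
  omega


/-! ### Geodesic paths -/

/-- `p 0, …, p d` behaves like a geodesic path of `G`. -/
structure Geo {V : Type} (G : SimpleGraph V) (d : ℕ) (p : ℕ → V) : Prop where
  inj : ∀ i j, i ≤ d → j ≤ d → p i = p j → i = j
  adj : ∀ i j, i ≤ d → j ≤ d → (G.Adj (p i) (p j) ↔ i + 1 = j ∨ j + 1 = i)
  near : ∀ w i j, i ≤ d → j ≤ d → G.Adj w (p i) → G.Adj w (p j) → j ≤ i + 2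
  near3 : ∀ w w' i j, i ≤ d → j ≤ d → G.Adj w (p i) → G.Adj w' (p j) → G.Adj w w' → j ≤ i + 3

/-- Vertex set of the path. -/
def pset {V : Type} [DecidableEq V] (d : ℕ) (p : ℕ → V) : Finset V :=
  (Finset.range (d + 1)).image p

lemma Geo.injOn {V : Type} {G : SimpleGraph V} {d : ℕ} {p : ℕ → V} (h : Geo G d p) :
    Set.InjOn p (Finset.range (d + 1)) := by
  intro i hi j hj hij
  simp only [Finset.coe_range, Set.mem_Iio] at hi hj
  exact h.inj i j (by omega) (by omega) hij

lemma Geo.sum {V : Type} [DecidableEq V] {G : SimpleGraph V} {d : ℕ} {p : ℕ → V} (h : Geo G d p)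
    (g : V → ℝ) : ∑ v ∈ pset d p, g v = ∑ i ∈ Finset.range (d + 1), g (p i) :=
  Finset.sum_image h.injOn

lemma Geo.card {V : Type} [DecidableEq V] {G : SimpleGraph V} {d : ℕ} {p : ℕ → V} (h : Geo G d p) :
    (pset d p).card = d + 1 := by
  unfold pset
  rw [Finset.card_image_of_injOn h.injOn, Finset.card_range]

lemma Geo.rev {V : Type} {G : SimpleGraph V} {d : ℕ} {p : ℕ → V} (h : Geo G d p) :
    Geo G d (fun i => p (d - i)) where
  inj i j hi hj hij := by
    have := h.inj _ _ (by omega) (by omega) hij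
    omega
  adj i j hi hj := by
    rw [h.adj _ _ (by omega) (by omega)]
    omega
  near w i j hi hj h1 h2 := by
    have := h.near w _ _ (by omega) (by omega) h2 h1
    omega
  near3 w w' i j hi hj h1 h2 h3 := by
    have := h.near3 w' w _ _ (by omega) (by omega) h2 h1 h3.symm
    omega

lemma exists_geo {V : Type} [Fintype V] (G : SimpleGraph V) (hG : G.Connected) (d : ℕ)
    (hd : G.diam = d) : ∃ p, Geo G d p := by
  have := hG.nonempty
  obtain ⟨a, b, hab⟩ := G.exists_dist_eq_diam
  obtain ⟨W, hW⟩ := hG.exists_walk_length_eq_dist a b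
  rw [hab, hd] at hW
  rw [hd] at hab
  have h1 : ∀ i j, i ≤ j → j ≤ d → G.dist (W.getVert i) (W.getVert j) ≤ j - i := by
    intro i j hij hj
    induction j, hij using Nat.le_induction with
    | base => simp
    | succ j hij ih =>
      have h2 := ih (by omega)
      have h3 := W.adj_getVert_succ (i := j) (by omega)
      have h4 := SimpleGraph.dist_eq_one_iff_adj.2 h3
      have h5 := hG.dist_triangle (u := W.getVert i) (v := W.getVert j) (w := W.getVert (j + 1))
      omega
  have h2 : ∀ i j, i ≤ d → j ≤ d → j - i ≤ G.dist (W.getVert i) (W.getVert j) := by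
    intro i j hi hj
    have e1 := h1 0 i (by omega) hi
    have e2 := h1 j d hj le_rfl
    have e3 := hG.dist_triangle (u := a) (v := W.getVert i) (w := b)
    have e4 := hG.dist_triangle (u := W.getVert i) (v := W.getVert j) (w := b)
    have e5 : W.getVert d = b := by rw [← hW]; exact W.getVert_length
    rw [W.getVert_zero] at e1
    rw [e5] at e2
    omega
  refine ⟨W.getVert, ⟨?_, ?_, ?_, ?_⟩⟩
  · intro i j hi hj hij
    have e1 := h2 i j hi hj
    have e2 := h2 j i hj hi
    rw [hij, SimpleGraph.dist_self] at e1
    rw [hij, SimpleGraph.dist_self] at e2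
    omega
  · intro i j hi hj
    constructor
    · intro h
      have e1 := h2 i j hi hj
      have e2 := h2 j i hj hi
      rw [SimpleGraph.dist_eq_one_iff_adj.2 h] at e1
      rw [SimpleGraph.dist_eq_one_iff_adj.2 h.symm] at e2
      have : i ≠ j := by rintro rfl; exact h.ne rfl
      omega
    · rintro (rfl | rfl)
      · exact W.adj_getVert_succ (by omega)
      · exact (W.adj_getVert_succ (by omega)).symm
  · intro w i j hi hj e1 e2
    have e3 := h2 i j hi hj
    have e4 := hG.dist_triangle (u := W.getVert i) (v := w) (w := W.getVert j)
    rw [SimpleGraph.dist_eq_one_iff_adj.2 e1.symm, SimpleGraph.dist_eq_one_iff_adj.2 e2] at e4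
    omega
  · intro w w' i j hi hj e1 e2 e5
    have e3 := h2 i j hi hj
    have e4 := hG.dist_triangle (u := W.getVert i) (v := w) (w := W.getVert j)
    have e6 := hG.dist_triangle (u := w) (v := w') (w := W.getVert j)
    rw [SimpleGraph.dist_eq_one_iff_adj.2 e1.symm] at e4
    rw [SimpleGraph.dist_eq_one_iff_adj.2 e5, SimpleGraph.dist_eq_one_iff_adj.2 e2] at e6
    omega

/-! ### Decomposition of the quadratic form -/

open Classical in
/-- Part of the (doubled) quadratic form living on `S`. -/
noncomputable def qS {V : Type} (G : SimpleGraph V) (S : Finset V) (x : V → ℝ) : ℝ :=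
  ∑ v ∈ S, ∑ w ∈ S, if G.Adj v w then (x v - x w) ^ 2 else 0

lemma sum_off {V : Type} [Fintype V] [DecidableEq V] (S : Finset V) (g : V → ℝ)
    (hg : ∀ v, v ∉ S → g v = 0) : ∑ v, g v = ∑ v ∈ S, g v :=
  (Finset.sum_subset (Finset.subset_univ S) (fun v _ hv => hg v hv)).symm

lemma qf_split {V : Type} [Fintype V] [DecidableEq V] (G : SimpleGraph V) (S : Finset V)
    (x : V → ℝ) (hx : ∀ v, v ∉ S → x v = 0) :
    qf G x ≤ qS G S x + 2 * ((Fintype.card V : ℝ) - S.card) * ∑ v ∈ S, x v ^ 2 := by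
  classical
  have hc : ((Sᶜ).card : ℝ) = (Fintype.card V : ℝ) - S.card := by
    rw [Finset.card_compl, Nat.cast_sub (Finset.card_le_univ S)]
  have key : qf G x = qS G S x
      + ∑ v ∈ S, ∑ w ∈ Sᶜ, (if G.Adj v w then (x v - x w) ^ 2 else 0)
      + ∑ v ∈ Sᶜ, ∑ w ∈ S, (if G.Adj v w then (x v - x w) ^ 2 else 0)
      + ∑ v ∈ Sᶜ, ∑ w ∈ Sᶜ, (if G.Adj v w then (x v - x w) ^ 2 else 0) := by
    unfold qf qS
    rw [← Finset.sum_add_sum_compl S]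
    simp_rw [← Finset.sum_add_sum_compl S
      (fun w => if G.Adj _ w then (x _ - x w) ^ 2 else 0), Finset.sum_add_distrib]
    ring
  have b1 : ∑ v ∈ S, ∑ w ∈ Sᶜ, (if G.Adj v w then (x v - x w) ^ 2 else 0)
      ≤ ((Sᶜ).card : ℝ) * ∑ v ∈ S, x v ^ 2 := by
    rw [Finset.mul_sum]
    refine Finset.sum_le_sum fun v _ => ?_
    rw [← nsmul_eq_mul]
    refine Finset.sum_le_card_nsmul _ _ _ fun w hw => ?_
    rw [hx w (Finset.mem_compl.1 hw), sub_zero]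
    split_ifs
    · exact le_rfl
    · positivity
  have b2 : ∑ v ∈ Sᶜ, ∑ w ∈ S, (if G.Adj v w then (x v - x w) ^ 2 else 0)
      ≤ ((Sᶜ).card : ℝ) * ∑ v ∈ S, x v ^ 2 := by
    rw [Finset.sum_comm, Finset.mul_sum]
    refine Finset.sum_le_sum fun v _ => ?_
    rw [← nsmul_eq_mul]
    refine Finset.sum_le_card_nsmul _ _ _ fun w hw => ?_
    rw [hx w (Finset.mem_compl.1 hw), zero_sub, neg_sq]
    split_ifs
    · exact le_rfl
    · positivity
  have b3 : ∑ v ∈ Sᶜ, ∑ w ∈ Sᶜ, (if G.Adj v w then (x v - x w) ^ 2 else 0) = 0 := by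
    refine Finset.sum_eq_zero fun v hv => Finset.sum_eq_zero fun w hw => ?_
    rw [hx v (Finset.mem_compl.1 hv), hx w (Finset.mem_compl.1 hw)]
    simp
  rw [hc] at b1 b2
  linarith

open Classical in
lemma qS_insert {V : Type} [DecidableEq V] (G : SimpleGraph V) (S : Finset V) (u : V) (hu : u ∉ S)
    (x : V → ℝ) : qS G (insert u S) x
      = qS G S x + 2 * ∑ v ∈ S, if G.Adj u v then (x u - x v) ^ 2 else 0 := by
  unfold qS
  rw [Finset.sum_insert hu, Finset.sum_insert hu]
  simp_rw [Finset.sum_insert hu]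
  rw [Finset.sum_add_distrib]
  have : ∀ v, (if G.Adj v u then (x v - x u) ^ 2 else 0)
      = if G.Adj u v then (x u - x v) ^ 2 else 0 := by
    intro v
    rw [G.adj_comm]
    split_ifs <;> ring
  simp_rw [this]
  simp
  ring

lemma Geo.qS {V : Type} [DecidableEq V] {G : SimpleGraph V} {d : ℕ} {p : ℕ → V} (h : Geo G d p)
    (x : V → ℝ) :
    qS G (pset d p) x = 2 * ∑ i ∈ Finset.range d, (x (p i) - x (p (i + 1))) ^ 2 := by
  classical
  unfold _root_.qS
  rw [h.sum]
  simp_rw [h.sum]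
  have e : ∀ i ∈ Finset.range (d + 1), ∀ j ∈ Finset.range (d + 1),
      (if G.Adj (p i) (p j) then (x (p i) - x (p j)) ^ 2 else 0)
      = (if i + 1 = j then (x (p i) - x (p j)) ^ 2 else 0)
        + (if j + 1 = i then (x (p i) - x (p j)) ^ 2 else 0) := by
    intro i hi j hj
    rw [Finset.mem_range] at hi hj
    have := h.adj i j (by omega) (by omega)
    by_cases h1 : i + 1 = j
    · have h2 : ¬ (j + 1 = i) := by omega
      simp [this, h1, h2]
    · by_cases h2 : j + 1 = i <;> simp [this, h1, h2]
  rw [Finset.sum_congr rfl fun i hi => Finset.sum_congr rfl (e i hi)]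
  simp_rw [Finset.sum_add_distrib]
  have e1 : ∑ i ∈ Finset.range (d + 1), ∑ j ∈ Finset.range (d + 1),
      (if i + 1 = j then (x (p i) - x (p j)) ^ 2 else 0)
      = ∑ i ∈ Finset.range d, (x (p i) - x (p (i + 1))) ^ 2 := by
    simp_rw [Finset.sum_ite_eq]
    rw [Finset.sum_range_succ]
    simp only [Finset.mem_range, lt_self_iff_false, if_false, add_zero]
    refine Finset.sum_congr rfl fun i hi => ?_
    rw [Finset.mem_range] at hi
    rw [if_pos (by omega)]
  have e2 : ∑ i ∈ Finset.range (d + 1), ∑ j ∈ Finset.range (d + 1),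
      (if j + 1 = i then (x (p i) - x (p j)) ^ 2 else 0)
      = ∑ i ∈ Finset.range d, (x (p i) - x (p (i + 1))) ^ 2 := by
    rw [← e1, Finset.sum_comm]
    refine Finset.sum_congr rfl fun i _ => Finset.sum_congr rfl fun j _ => ?_
    split_ifs <;> ring
  rw [e1, e2]
  ring

lemma path_id (y : ℕ → ℝ) (d : ℕ) :
    4 * ∑ i ∈ Finset.range (d + 1), y i ^ 2 = ∑ i ∈ Finset.range d, (y i - y (i + 1)) ^ 2
      + (2 * y 0 ^ 2 + 2 * y d ^ 2 + ∑ i ∈ Finset.range d, (y i + y (i + 1)) ^ 2) := by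
  induction d with
  | zero => simp; ring
  | succ d ih =>
    rw [Finset.sum_range_succ, mul_add, ih, Finset.sum_range_succ _ d, Finset.sum_range_succ _ d]
    ring

/-- The defect of the path form. -/
noncomputable def EE (y : ℕ → ℝ) (d : ℕ) : ℝ :=
  2 * y 0 ^ 2 + 2 * y d ^ 2 + ∑ i ∈ Finset.range d, (y i + y (i + 1)) ^ 2

open Classical in
lemma coreA {V : Type} [Fintype V] [DecidableEq V] {G : SimpleGraph V} {d : ℕ} {p : ℕ → V}
    (h : Geo G d p) (u : V) (hu : u ∉ pset d p) {r : ℕ} (f : Fin r → ((V → ℝ) →ₗ[ℝ] ℝ))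
    (H : ∀ x : V → ℝ, (∀ k, f k x = 0) →
      EE (fun i => x (p i)) d + 4 * x u ^ 2 ≤
        ∑ i ∈ Finset.range (d + 1), (if G.Adj u (p i) then (x u - x (p i)) ^ 2 else 0) →
      x u = 0 ∧ ∀ j, j ≤ d → x (p j) = 0) :
    cnt G ((Fintype.card V : ℝ) - d + 2) + d + 2 ≤ Fintype.card V + r := by
  have := cnt_le' G ((Fintype.card V : ℝ) - d + 2) (insert u (pset d p)) f (by
    intro x hx hf hq
    have h1 := qf_split G _ x hx
    rw [sum_off _ (fun v => x v ^ 2) (fun v hv => by simp [hx v hv])] at hq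
    rw [qS_insert G _ u hu, h.qS, Finset.card_insert_of_notMem hu, h.card] at h1
    rw [Finset.sum_insert hu, h.sum] at h1 hq
    rw [h.sum] at h1
    have h3 := path_id (fun i => x (p i)) d
    push_cast at h1
    obtain ⟨a, b⟩ := H x hf (by unfold EE; linarith)
    ext v
    by_cases hv : v ∈ insert u (pset d p)
    · rcases Finset.mem_insert.1 hv with rfl | hv
      · exact a
      · obtain ⟨j, hj, rfl⟩ := Finset.mem_image.1 hv
        exact b j (by rw [Finset.mem_range] at hj; omega)
    · exact hx v hv)
  rw [Finset.card_insert_of_notMem hu, h.card] at this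
  omega

open Classical in
lemma coreB {V : Type} [Fintype V] [DecidableEq V] {G : SimpleGraph V} {d : ℕ} {p : ℕ → V}
    (h : Geo G d p) (u w : V) (hu : u ∉ pset d p) (hw : w ∉ pset d p) (huw : u ≠ w)
    {r : ℕ} (f : Fin r → ((V → ℝ) →ₗ[ℝ] ℝ))
    (H : ∀ x : V → ℝ, (∀ k, f k x = 0) →
      EE (fun i => x (p i)) d + ∑ i ∈ Finset.range (d + 1), x (p i) ^ 2
        + 5 * x u ^ 2 + 5 * x w ^ 2 ≤
        ∑ i ∈ Finset.range (d + 1), (if G.Adj u (p i) then (x u - x (p i)) ^ 2 else 0) +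
        ∑ i ∈ Finset.range (d + 1), (if G.Adj w (p i) then (x w - x (p i)) ^ 2 else 0) +
        (if G.Adj u w then (x u - x w) ^ 2 else 0) →
      x u = 0 ∧ x w = 0 ∧ ∀ j, j ≤ d → x (p j) = 0) :
    cnt G ((Fintype.card V : ℝ) - d + 2) + d + 3 ≤ Fintype.card V + r := by
  have hu' : u ∉ insert w (pset d p) := by
    rw [Finset.mem_insert]
    push Not
    exact ⟨huw, hu⟩
  have := cnt_le' G ((Fintype.card V : ℝ) - d + 2) (insert u (insert w (pset d p))) f (by
    intro x hx hf hq
    have h1 := qf_split G _ x hx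
    rw [sum_off (insert u (insert w (pset d p))) (fun v => x v ^ 2) (fun v hv => by simp [hx v hv])] at hq
    rw [qS_insert G _ u hu', qS_insert G _ w hw, h.qS, Finset.card_insert_of_notMem hu',
      Finset.card_insert_of_notMem hw, h.card] at h1
    simp only [Finset.sum_insert hu', Finset.sum_insert hw, h.sum] at h1 hq
    have h3 := path_id (fun i => x (p i)) d
    push_cast at h1
    obtain ⟨a, a', b⟩ := H x hf (by unfold EE; linarith)
    ext v
    by_cases hv : v ∈ insert u (insert w (pset d p))
    · rcases Finset.mem_insert.1 hv with rfl | hv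
      · exact a
      · rcases Finset.mem_insert.1 hv with rfl | hv
        · exact a'
        · obtain ⟨j, hj, rfl⟩ := Finset.mem_image.1 hv
          exact b j (by rw [Finset.mem_range] at hj; omega)
    · exact hx v hv)
  rw [Finset.card_insert_of_notMem hu', Finset.card_insert_of_notMem hw, h.card] at this
  omega

/-! ### Local inequalities -/

lemma EE_ge (y : ℕ → ℝ) (d a b : ℕ) (hb : b ≤ d) :
    ∑ i ∈ Finset.Ico a b, (y i + y (i + 1)) ^ 2 ≤ EE y d := by
  unfold EE
  have : ∑ i ∈ Finset.Ico a b, (y i + y (i + 1)) ^ 2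
      ≤ ∑ i ∈ Finset.range d, (y i + y (i + 1)) ^ 2 := by
    refine Finset.sum_le_sum_of_subset_of_nonneg ?_ (fun i _ _ => sq_nonneg _)
    intro i hi
    rw [Finset.mem_Ico] at hi
    rw [Finset.mem_range]
    omega
  nlinarith [sq_nonneg (y 0), sq_nonneg (y d)]

lemma EE_chain (y : ℕ → ℝ) (d a b : ℕ) (hab : a ≤ b) (hb : b ≤ d)
    (h : EE y d ≤ ∑ i ∈ Finset.Ico a b, (y i + y (i + 1)) ^ 2) :
    (∀ j, j ≤ a → y j = 0) ∧ (∀ j, b ≤ j → j ≤ d → y j = 0) := by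
  unfold EE at h
  have hs : Finset.Ico a b ⊆ Finset.range d := by
    intro i hi
    rw [Finset.mem_Ico] at hi
    rw [Finset.mem_range]
    omega
  rw [← Finset.sum_sdiff hs] at h
  have hn : 0 ≤ ∑ i ∈ Finset.range d \ Finset.Ico a b, (y i + y (i + 1)) ^ 2 :=
    Finset.sum_nonneg fun i _ => sq_nonneg _
  have h0 : y 0 = 0 := by
    have : y 0 ^ 2 ≤ 0 := by nlinarith [sq_nonneg (y d)]
    nlinarith
  have hd : y d = 0 := by
    have : y d ^ 2 ≤ 0 := by nlinarith [sq_nonneg (y 0)]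
    nlinarith
  have hz : ∑ i ∈ Finset.range d \ Finset.Ico a b, (y i + y (i + 1)) ^ 2 = 0 := by
    rw [h0, hd] at h
    linarith
  rw [Finset.sum_eq_zero_iff_of_nonneg fun i _ => sq_nonneg _] at hz
  have hz' : ∀ i, i < d → (i < a ∨ b ≤ i) → y i + y (i + 1) = 0 := by
    intro i hi hab'
    have := hz i (by
      rw [Finset.mem_sdiff, Finset.mem_range, Finset.mem_Ico]
      omega)
    exact pow_eq_zero_iff (two_ne_zero) |>.1 this
  constructor
  · intro j
    induction j with
    | zero => intro _; exact h0
    | succ j ih =>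
      intro hj
      have := hz' j (by omega) (by omega)
      rw [ih (by omega)] at this
      linarith
  · intro j hbj hj
    induction hk : d - j generalizing j with
    | zero =>
      have : j = d := by omega
      rw [this, hd]
    | succ k ih =>
      have h1 := ih (j + 1) (by omega) (by omega) (by omega)
      have := hz' j (by omega) (by omega)
      rw [h1] at this
      linarith

lemma sq_ge (y : ℕ → ℝ) (d a b : ℕ) (hb : b ≤ d + 1) :
    ∑ i ∈ Finset.Ico a b, y i ^ 2 ≤ ∑ i ∈ Finset.range (d + 1), y i ^ 2 := by
  refine Finset.sum_le_sum_of_subset_of_nonneg ?_ (fun i _ _ => sq_nonneg _)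
  intro i hi
  rw [Finset.mem_Ico] at hi
  rw [Finset.mem_range]
  omega

open Classical in
lemma sum_nbr (Q : ℕ → Prop) (d : ℕ) (N : Finset ℕ) (hN : ∀ j ∈ N, j ≤ d)
    (hQ : ∀ j, j ≤ d → (Q j ↔ j ∈ N)) (g : ℕ → ℝ) :
    ∑ i ∈ Finset.range (d + 1), (if Q i then g i else 0) = ∑ i ∈ N, g i := by
  rw [← Finset.sum_filter]
  refine Finset.sum_congr ?_ fun _ _ => rfl
  ext j
  rw [Finset.mem_filter, Finset.mem_range]
  constructor
  · rintro ⟨h1, h2⟩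
    exact (hQ j (by omega)).1 h2
  · intro h1
    have := hN j h1
    exact ⟨by omega, (hQ j this).2 h1⟩

lemma sq_zero_of_le {a : ℝ} (h : a ^ 2 ≤ 0) : a = 0 := by nlinarith


/-- Evaluation functional at a vertex. -/
def ev {V : Type} (v : V) : (V → ℝ) →ₗ[ℝ] ℝ := LinearMap.proj v

lemma ev_apply {V : Type} (v : V) (x : V → ℝ) : ev v x = x v := rfl

/-! ### Consequences of many large eigenvalues -/

lemma exists_window {V : Type} {G : SimpleGraph V} {d : ℕ} {p : ℕ → V} (h : Geo G d p)
    (hd : 2 ≤ d) (u : V) : ∃ i, i + 2 ≤ d ∧ ∀ j, j ≤ d → G.Adj u (p j) → i ≤ j ∧ j ≤ i + 2 := by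
  classical
  by_cases hex : ∃ j, j ≤ d ∧ G.Adj u (p j)
  · obtain ⟨hm, hmadj⟩ := Nat.find_spec hex
    set m := Nat.find hex with hmdef
    have hmin : ∀ j, j ≤ d → G.Adj u (p j) → m ≤ j := fun j hj ha => Nat.find_min' hex ⟨hj, ha⟩
    have hmax : ∀ j, j ≤ d → G.Adj u (p j) → j ≤ m + 2 :=
      fun j hj ha => h.near u m j hm hj hmadj ha
    refine ⟨min m (d - 2), by omega, fun j hj ha => ?_⟩
    have := hmin j hj ha
    have := hmax j hj ha
    omega
  · push Not at hex
    exact ⟨0, by omega, fun j hj ha => absurd ha (hex j hj)⟩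

lemma upper {V : Type} [Fintype V] [DecidableEq V] {G : SimpleGraph V} {d : ℕ} {p : ℕ → V}
    (h : Geo G d p) (hd : 2 ≤ d) (u : V) (hu : u ∉ pset d p) :
    cnt G ((Fintype.card V : ℝ) - d + 2) + d ≤ Fintype.card V := by
  classical
  obtain ⟨i, hi, hN⟩ := exists_window h hd u
  have := coreA h u hu (r := 2) ![ev u, ev (p (i + 1))] (by
    intro x hf hc
    have f1 : x u = 0 := hf 0
    have f2 : x (p (i + 1)) = 0 := hf 1
    have hle : ∑ i ∈ Finset.range (d + 1), (if G.Adj u (p i) then (x u - x (p i)) ^ 2 else 0)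
        ≤ ∑ j ∈ Finset.Ico i (i + 3), x (p j) ^ 2 := by
      rw [← sum_nbr (fun j => j ∈ Finset.Ico i (i + 3)) d (Finset.Ico i (i + 3))
        (by intro j hj; rw [Finset.mem_Ico] at hj; omega) (fun _ _ => Iff.rfl)]
      refine Finset.sum_le_sum fun j hj => ?_
      rw [Finset.mem_range] at hj
      rw [f1]
      by_cases ha : G.Adj u (p j)
      · have := hN j (by omega) ha
        rw [if_pos ha, if_pos (by rw [Finset.mem_Ico]; omega)]
        exact le_of_eq (by ring)
      · rw [if_neg ha]
        split_ifs <;> positivity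
    have hch := EE_chain (fun i => x (p i)) d i (i + 2) (by omega) (by omega) (by
      simp [Finset.sum_Ico_succ_top, f2] at hle ⊢
      nlinarith [sq_nonneg (x u)])
    refine ⟨f1, fun j hj => ?_⟩
    by_cases h1 : j ≤ i
    · exact hch.1 j h1
    · by_cases h2 : i + 2 ≤ j
      · exact hch.2 j h2 hj
      · have : j = i + 1 := by omega
        rw [this, f2])
  omega

lemma triple {V : Type} [Fintype V] [DecidableEq V] {G : SimpleGraph V} {d : ℕ} {p : ℕ → V}
    (h : Geo G d p) (hd : 2 ≤ d) (u : V) (hu : u ∉ pset d p)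
    (hc : Fintype.card V ≤ cnt G ((Fintype.card V : ℝ) - d + 2) + d) :
    ∃ i, i + 2 ≤ d ∧ ∀ j, j ≤ d → (G.Adj u (p j) ↔ i ≤ j ∧ j ≤ i + 2) := by
  classical
  -- no neighbours
  have A0 : ¬ (∀ j, j ≤ d → ¬ G.Adj u (p j)) := by
    intro hN
    have := coreA h u hu (r := 1) ![ev u] (by
      intro x hf hc
      have f1 : x u = 0 := hf 0
      rw [sum_nbr _ d ∅ (by simp) (by simpa using hN)] at hc
      have hch := EE_chain (fun i => x (p i)) d 0 0 (by omega) (by omega) (by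
        simp at hc ⊢
        nlinarith [sq_nonneg (x u)])
      exact ⟨f1, fun j hj => hch.2 j (by omega) hj⟩)
    omega
  -- one neighbour
  have A1 : ∀ i, i ≤ d → ¬ (∀ j, j ≤ d → (G.Adj u (p j) ↔ j ∈ ({i} : Finset ℕ))) := by
    intro i hi hN
    have := coreA h u hu (r := 1) ![ev (p i)] (by
      intro x hf hc
      have f1 : x (p i) = 0 := hf 0
      rw [sum_nbr _ d {i} (by simpa using hi) hN] at hc
      have hnn := EE_ge (fun i => x (p i)) d i i hi
      have hch := EE_chain (fun i => x (p i)) d i i (by omega) (by omega) (by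
        simp [f1] at hc hnn ⊢
        nlinarith [sq_nonneg (x u)])
      refine ⟨sq_zero_of_le ?_, fun j hj => ?_⟩
      · simp [f1] at hc hnn
        nlinarith
      · rcases le_total j i with h1 | h1
        · exact hch.1 j h1
        · exact hch.2 j h1 hj)
    omega
  -- two adjacent neighbours
  have A2 : ∀ i, i + 1 ≤ d → ¬ (∀ j, j ≤ d → (G.Adj u (p j) ↔ j ∈ ({i, i + 1} : Finset ℕ))) := by
    intro i hi hN
    have := coreA h u hu (r := 1) ![ev (p i) - ev (p (i + 1))] (by
      intro x hf hc
      have f1 : x (p i) - x (p (i + 1)) = 0 := by simpa [ev_apply] using hf 0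
      have f2 : x (p (i + 1)) = x (p i) := by linarith
      rw [sum_nbr _ d {i, i + 1} (by simp; omega) hN] at hc
      have hnn := EE_ge (fun i => x (p i)) d i (i + 1) hi
      rw [Finset.sum_pair (by omega)] at hc
      simp only [Finset.sum_Ico_succ_top le_rfl, Finset.Ico_self, Finset.sum_empty, f2]
        at hc hnn
      have hch := EE_chain (fun i => x (p i)) d i (i + 1) (by omega) (by omega) (by
        simp [f2]
        nlinarith [sq_nonneg (x u + x (p i))])
      have hi0 : x (p i) = 0 := hch.1 i le_rfl
      rw [hi0] at hc hnn
      refine ⟨sq_zero_of_le ?_, fun j hj => ?_⟩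
      · nlinarith
      · rcases le_or_gt j i with h1 | h1
        · exact hch.1 j h1
        · exact hch.2 j h1 hj)
    omega
  -- two neighbours at distance two
  have A3 : ∀ i, i + 2 ≤ d → ¬ (∀ j, j ≤ d → (G.Adj u (p j) ↔ j ∈ ({i, i + 2} : Finset ℕ))) := by
    intro i hi hN
    have := coreA h u hu (r := 1) ![ev (p i) + ev (p (i + 2))] (by
      intro x hf hc
      have f1 : x (p i) + x (p (i + 2)) = 0 := by simpa [ev_apply] using hf 0
      have f2 : x (p (i + 2)) = - x (p i) := by linarith
      rw [sum_nbr _ d {i, i + 2} (by simp; omega) hN] at hc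
      have hnn := EE_ge (fun i => x (p i)) d i (i + 2) hi
      rw [Finset.sum_pair (by omega)] at hc
      simp [Finset.sum_Ico_succ_top, f2] at hc hnn
      have hch := EE_chain (fun i => x (p i)) d i (i + 2) (by omega) (by omega) (by
        simp [Finset.sum_Ico_succ_top, f2]
        nlinarith [sq_nonneg (x u), sq_nonneg (x (p (i + 1)))])
      refine ⟨sq_zero_of_le ?_, fun j hj => ?_⟩
      · nlinarith [sq_nonneg (x (p (i + 1)))]
      · rcases le_or_gt j i with h1 | h1
        · exact hch.1 j h1
        · by_cases h2 : j = i + 1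
          · rw [h2]
            apply sq_zero_of_le
            nlinarith [sq_nonneg (x u)]
          · exact hch.2 j (by omega) hj)
    omega
  obtain ⟨i, hi, hN⟩ := exists_window h hd u
  refine ⟨i, hi, fun j hj => ⟨hN j hj, ?_⟩⟩
  by_contra hcon
  have hmem : ∀ N : Finset ℕ, (G.Adj u (p i) ↔ i ∈ N) → (G.Adj u (p (i + 1)) ↔ i + 1 ∈ N) →
      (G.Adj u (p (i + 2)) ↔ i + 2 ∈ N) → (∀ j ∈ N, i ≤ j ∧ j ≤ i + 2) →
      ∀ j, j ≤ d → (G.Adj u (p j) ↔ j ∈ N) := by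
    intro N h0 h1 h2 hb j hj
    by_cases e0 : j = i
    · rw [e0]; exact h0
    by_cases e1 : j = i + 1
    · rw [e1]; exact h1
    by_cases e2 : j = i + 2
    · rw [e2]; exact h2
    constructor
    · intro ha
      have := hN j hj ha
      omega
    · intro ha
      have := hb j ha
      omega
  by_cases a0 : G.Adj u (p i) <;> by_cases a1 : G.Adj u (p (i + 1)) <;>
    by_cases a2 : G.Adj u (p (i + 2))
  · apply hcon
    rintro ⟨b1, b2⟩
    have : j = i ∨ j = i + 1 ∨ j = i + 2 := by omega
    rcases this with rfl | rfl | rfl <;> assumption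
  · exact A2 i (by omega) (hmem _ (by simp [a0]) (by simp [a1]) (by simp [a2])
      (by simp))
  · exact A3 i (by omega) (hmem _ (by simp [a0]) (by simp [a1]) (by simp [a2])
      (by simp))
  · exact A1 i (by omega) (hmem _ (by simp [a0]) (by simp [a1]) (by simp [a2])
      (by simp))
  · exact A2 (i + 1) (by omega) (hmem _ (by simp [a0]; omega) (by simp [a1]) (by simp [a2])
      (by simp; omega))
  · exact A1 (i + 1) (by omega) (hmem _ (by simp [a0]) (by simp [a1]) (by simp [a2])
      (by simp))
  · exact A1 (i + 2) (by omega) (hmem _ (by simp [a0]) (by simp [a1]) (by simp [a2])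
      (by simp))
  · apply A0
    intro j hj ha
    have := hN j hj ha
    have : j = i ∨ j = i + 1 ∨ j = i + 2 := by omega
    rcases this with rfl | rfl | rfl <;> contradiction

lemma pair_le {V : Type} [Fintype V] [DecidableEq V] {G : SimpleGraph V} {d : ℕ} {p : ℕ → V}
    (h : Geo G d p) (u w : V) (hu : u ∉ pset d p) (hw : w ∉ pset d p) (huw : u ≠ w)
    (hc : Fintype.card V ≤ cnt G ((Fintype.card V : ℝ) - d + 2) + d)
    (i k : ℕ) (hi : i + 2 ≤ d) (hk : k + 2 ≤ d) (hik : i ≤ k)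
    (hNi : ∀ j, j ≤ d → (G.Adj u (p j) ↔ i ≤ j ∧ j ≤ i + 2))
    (hNk : ∀ j, j ≤ d → (G.Adj w (p j) ↔ k ≤ j ∧ j ≤ k + 2)) :
    G.Adj u w ∧ k ≤ i + 1 := by
  classical
  have hNi' : ∀ j, j ≤ d → (G.Adj u (p j) ↔ j ∈ Finset.Ico i (i + 3)) := by
    intro j hj
    rw [hNi j hj, Finset.mem_Ico]
    omega
  have hNk' : ∀ j, j ≤ d → (G.Adj w (p j) ↔ j ∈ Finset.Ico k (k + 3)) := by
    intro j hj
    rw [hNk j hj, Finset.mem_Ico]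
    omega
  have hIi : ∀ j ∈ Finset.Ico i (i + 3), j ≤ d := by
    intro j hj
    rw [Finset.mem_Ico] at hj
    omega
  have hIk : ∀ j ∈ Finset.Ico k (k + 3), j ≤ d := by
    intro j hj
    rw [Finset.mem_Ico] at hj
    omega
  have hk1 : k ≤ i + 1 := by
    by_contra hcon
    by_cases hk2 : k = i + 2
    · subst hk2
      have hna : ¬ G.Adj u w := by
        intro ha
        have := h.near3 u w i (i + 4) (by omega) (by omega) ((hNi i (by omega)).2 (by omega))
          ((hNk (i + 4) (by omega)).2 (by omega)) ha
        omega
      have := coreB h u w hu hw huw (r := 1) ![ev (p (i + 2))] (by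
        intro x hf hc
        have f1 : x (p (i + 2)) = 0 := hf 0
        rw [sum_nbr _ d _ hIi hNi', sum_nbr _ d _ hIk hNk', if_neg hna] at hc
        have hnn := EE_ge (fun i => x (p i)) d i (i + 4) (by omega)
        have hsq := sq_ge (fun i => x (p i)) d i (i + 5) (by omega)
        simp [Finset.sum_Ico_succ_top, f1] at hc hnn hsq
        have s1 := sq_nonneg (x u + x (p (i + 1)) + x (p i))
        have s2 := sq_nonneg (x w + x (p (i + 3)) + x (p (i + 4)))
        have s3 := sq_nonneg (x u)
        have s4 := sq_nonneg (x w)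
        have s5 := sq_nonneg (x (p (i + 1)))
        have s6 := sq_nonneg (x (p (i + 3)))
        have hch := EE_chain (fun i => x (p i)) d i (i + 4) (by omega) (by omega) (by
          simp [Finset.sum_Ico_succ_top, f1]
          nlinarith)
        refine ⟨sq_zero_of_le (by nlinarith), sq_zero_of_le (by nlinarith), fun j hj => ?_⟩
        rcases le_or_gt j i with h1 | h1
        · exact hch.1 j h1
        rcases le_or_gt (i + 4) j with h2 | h2
        · exact hch.2 j h2 hj
        have : j = i + 1 ∨ j = i + 2 ∨ j = i + 3 := by omega
        rcases this with rfl | rfl | rfl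
        · exact sq_zero_of_le (by nlinarith)
        · exact f1
        · exact sq_zero_of_le (by nlinarith))
      omega
    · have := coreB h u w hu hw huw (r := 2) ![ev u, ev w] (by
        intro x hf hc
        have f1 : x u = 0 := hf 0
        have f2 : x w = 0 := hf 1
        rw [sum_nbr _ d _ hIi hNi', sum_nbr _ d _ hIk hNk', f1, f2] at hc
        have hdis : Disjoint (Finset.Ico i (i + 3)) (Finset.Ico k (k + 3)) := by
          rw [Finset.disjoint_left]
          intro j
          rw [Finset.mem_Ico, Finset.mem_Ico]
          omega
        have hle : ∑ j ∈ Finset.Ico i (i + 3) ∪ Finset.Ico k (k + 3), x (p j) ^ 2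
            ≤ ∑ j ∈ Finset.range (d + 1), x (p j) ^ 2 := by
          refine Finset.sum_le_sum_of_subset_of_nonneg ?_ (fun i _ _ => sq_nonneg _)
          intro j
          rw [Finset.mem_union, Finset.mem_Ico, Finset.mem_Ico, Finset.mem_range]
          omega
        rw [Finset.sum_union hdis] at hle
        have hch := EE_chain (fun i => x (p i)) d 0 0 (by omega) (by omega) (by
          simp only [zero_sub, neg_sq, sub_self] at hc
          simp only [Finset.Ico_self, Finset.sum_empty]
          simp only [ne_eq, OfNat.ofNat_ne_zero, not_false_eq_true, zero_pow, ite_self, mul_zero,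
            add_zero] at hc
          linarith)
        exact ⟨f1, f2, fun j hj => hch.2 j (by omega) hj⟩)
      omega
  refine ⟨?_, hk1⟩
  by_contra hna
  by_cases hk2 : k = i
  · subst hk2
    have := coreB h u w hu hw huw (r := 2)
      ![ev (p (k + 1)), ev u + ev w] (by
      intro x hf hc
      have f1 : x (p (k + 1)) = 0 := hf 0
      have f2' : x u + x w = 0 := by simpa [ev_apply] using hf 1
      have f2 : x w = - x u := by linarith
      rw [sum_nbr _ d _ hIi hNi', sum_nbr _ d _ hIk hNk', if_neg hna] at hc
      have hnn := EE_ge (fun i => x (p i)) d k (k + 2) (by omega)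
      have hsq := sq_ge (fun i => x (p i)) d k (k + 3) (by omega)
      simp [Finset.sum_Ico_succ_top, f1, f2] at hc hnn hsq
      have s3 := sq_nonneg (x u)
      have hch := EE_chain (fun i => x (p i)) d k (k + 2) (by omega) (by omega) (by
        simp [Finset.sum_Ico_succ_top, f1]
        nlinarith)
      have hu0 : x u = 0 := sq_zero_of_le (by nlinarith)
      refine ⟨hu0, by rw [f2, hu0, neg_zero], fun j hj => ?_⟩
      rcases le_or_gt j k with h1 | h1
      · exact hch.1 j h1
      rcases le_or_gt (k + 2) j with h2 | h2
      · exact hch.2 j h2 hj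
      have : j = k + 1 := by omega
      rw [this, f1])
    omega
  · obtain rfl : k = i + 1 := by omega
    have := coreB h u w hu hw huw (r := 2)
      ![ev (p (i + 1)) - ev (p (i + 2)),
        ev u + ev w] (by
      intro x hf hc
      have f1' : x (p (i + 1)) - x (p (i + 2)) = 0 := by simpa [ev_apply] using hf 0
      have f1 : x (p (i + 2)) = x (p (i + 1)) := by linarith
      have f2' : x u + x w = 0 := by simpa [ev_apply] using hf 1
      have f2 : x w = - x u := by linarith
      rw [sum_nbr _ d _ hIi hNi', sum_nbr _ d _ hIk hNk', if_neg hna] at hc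
      have hnn := EE_ge (fun i => x (p i)) d i (i + 3) (by omega)
      have hsq := sq_ge (fun i => x (p i)) d i (i + 4) (by omega)
      simp [Finset.sum_Ico_succ_top, f1, f2] at hc hnn hsq
      have s1 := sq_nonneg (x (p i) + x (p (i + 1)) + x u)
      have s2 := sq_nonneg (x (p (i + 3)) + x (p (i + 1)) - x u)
      have s3 := sq_nonneg (x u)
      have s4 := sq_nonneg (x (p (i + 1)))
      have hch := EE_chain (fun i => x (p i)) d i (i + 3) (by omega) (by omega) (by
        simp [Finset.sum_Ico_succ_top, f1]
        nlinarith)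
      have hu0 : x u = 0 := sq_zero_of_le (by nlinarith)
      have hy0 : x (p (i + 1)) = 0 := sq_zero_of_le (by nlinarith)
      refine ⟨hu0, by rw [f2, hu0, neg_zero], fun j hj => ?_⟩
      rcases le_or_gt j i with h1 | h1
      · exact hch.1 j h1
      rcases le_or_gt (i + 3) j with h2 | h2
      · exact hch.2 j h2 hj
      have : j = i + 1 ∨ j = i + 2 := by omega
      rcases this with rfl | rfl
      · exact hy0
      · rw [f1, hy0])
    omega


/-! ### Lower bounds -/

lemma qf_lower {V : Type} [Fintype V] [DecidableEq V] (G : SimpleGraph V) (S : Finset V)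
    (x : V → ℝ) (hx : ∀ v, v ∉ S → x v = 0) (g : V → ℕ)
    (hg : ∀ v ∈ S, g v = 0 ∨ (g v = 1 ∧ ∃ w, w ∉ S ∧ G.Adj v w)) :
    qS G S x + 2 * ∑ v ∈ S, g v * x v ^ 2 ≤ qf G x := by
  classical
  have key : qf G x = qS G S x
      + ∑ v ∈ S, ∑ w ∈ Sᶜ, (if G.Adj v w then (x v - x w) ^ 2 else 0)
      + ∑ v ∈ Sᶜ, ∑ w ∈ S, (if G.Adj v w then (x v - x w) ^ 2 else 0)
      + ∑ v ∈ Sᶜ, ∑ w ∈ Sᶜ, (if G.Adj v w then (x v - x w) ^ 2 else 0) := by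
    unfold qf qS
    rw [← Finset.sum_add_sum_compl S]
    simp_rw [← Finset.sum_add_sum_compl S
      (fun w => if G.Adj _ w then (x _ - x w) ^ 2 else 0), Finset.sum_add_distrib]
    ring
  have b1 : ∑ v ∈ S, g v * x v ^ 2
      ≤ ∑ v ∈ S, ∑ w ∈ Sᶜ, (if G.Adj v w then (x v - x w) ^ 2 else 0) := by
    refine Finset.sum_le_sum fun v hv => ?_
    have hnn : ∀ w ∈ Sᶜ, 0 ≤ (if G.Adj v w then (x v - x w) ^ 2 else 0) := by
      intro w _
      split_ifs <;> positivity
    rcases hg v hv with h0 | ⟨h1, w, hw, ha⟩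
    · rw [h0]
      simpa using Finset.sum_nonneg hnn
    · have := Finset.single_le_sum hnn (Finset.mem_compl.2 hw)
      rw [if_pos ha, hx w hw] at this
      rw [h1]
      simpa using this
  have b2 : ∑ v ∈ Sᶜ, ∑ w ∈ S, (if G.Adj v w then (x v - x w) ^ 2 else 0)
      = ∑ v ∈ S, ∑ w ∈ Sᶜ, (if G.Adj v w then (x v - x w) ^ 2 else 0) := by
    rw [Finset.sum_comm]
    refine Finset.sum_congr rfl fun v _ => Finset.sum_congr rfl fun w _ => ?_
    rw [G.adj_comm]
    split_ifs <;> ring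
  have b3 : 0 ≤ ∑ v ∈ Sᶜ, ∑ w ∈ Sᶜ, (if G.Adj v w then (x v - x w) ^ 2 else 0) := by
    refine Finset.sum_nonneg fun v hv => Finset.sum_nonneg fun w hw => ?_
    split_ifs <;> positivity
  linarith

lemma lower1 {V : Type} [Fintype V] [DecidableEq V] (G : SimpleGraph V) (S : Finset V) (d : ℕ)
    (a b : V) (hS : ∀ v ∈ S, ∀ w ∈ S, v ≠ w → ¬ (v = a ∧ w = b) → ¬ (v = b ∧ w = a) → G.Adj v w)
    (hcard : S.card + d = Fintype.card V + 2) :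
    Fintype.card V ≤ cnt G ((Fintype.card V : ℝ) - d + 2) + d := by
  classical
  have := cnt_ge' G ((Fintype.card V : ℝ) - d + 2) S (r := 2)
    ![∑ v ∈ S, ev v, ev a - ev b] (by
    intro x hx hf
    have f1 : ∑ v ∈ S, x v = 0 := by simpa [ev_apply] using hf 0
    have f2 : x a - x b = 0 := by simpa [ev_apply] using hf 1
    have f2' : x a = x b := by linarith
    have h1 := qf_lower G S x hx (fun _ => 0) (fun _ _ => Or.inl rfl)
    have h2 : ∑ v ∈ S, ∑ w ∈ S, (x v - x w) ^ 2 ≤ qS G S x := by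
      unfold qS
      refine Finset.sum_le_sum fun v hv => Finset.sum_le_sum fun w hw => ?_
      by_cases ha : G.Adj v w
      · rw [if_pos ha]
      · rw [if_neg ha]
        have : x v = x w := by
          by_contra hne
          apply ha
          apply hS v hv w hw
          · rintro rfl; exact hne rfl
          · rintro ⟨rfl, rfl⟩; exact hne f2'
          · rintro ⟨rfl, rfl⟩; exact hne f2'.symm
        rw [this]
        simp
    rw [sum_sq_diff, f1] at h2
    rw [sum_off S (fun v => x v ^ 2) (fun v hv => by simp [hx v hv])]
    have hc : (S.card : ℝ) = (Fintype.card V : ℝ) - d + 2 := by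
      have : (S.card : ℝ) + d = Fintype.card V + 2 := by exact_mod_cast hcard
      linarith
    rw [hc] at h2
    simp only [Nat.cast_zero, zero_mul, Finset.sum_const_zero] at h1
    linarith)
  omega

lemma lower2 {V : Type} [Fintype V] [DecidableEq V] (G : SimpleGraph V) (S : Finset V) (d : ℕ)
    (hS : ∀ v ∈ S, ∀ w ∈ S, v ≠ w → G.Adj v w) (hout : ∀ v ∈ S, ∃ w, w ∉ S ∧ G.Adj v w)
    (hcard : S.card + d = Fintype.card V + 1) :
    Fintype.card V ≤ cnt G ((Fintype.card V : ℝ) - d + 2) + d := by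
  classical
  have := cnt_ge' G ((Fintype.card V : ℝ) - d + 2) S (r := 1)
    ![∑ v ∈ S, ev v] (by
    intro x hx hf
    have f1 : ∑ v ∈ S, x v = 0 := by simpa [ev_apply] using hf 0
    have h1 := qf_lower G S x hx (fun _ => 1) (fun v hv => Or.inr ⟨rfl, hout v hv⟩)
    have h2 : ∑ v ∈ S, ∑ w ∈ S, (x v - x w) ^ 2 ≤ qS G S x := by
      unfold qS
      refine Finset.sum_le_sum fun v hv => Finset.sum_le_sum fun w hw => ?_
      by_cases ha : G.Adj v w
      · rw [if_pos ha]
      · rw [if_neg ha]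
        have : v = w := by
          by_contra hne
          exact ha (hS v hv w hw hne)
        rw [this]
        simp
    rw [sum_sq_diff, f1] at h2
    rw [sum_off S (fun v => x v ^ 2) (fun v hv => by simp [hx v hv])]
    have hc : (S.card : ℝ) = (Fintype.card V : ℝ) - d + 1 := by
      have : (S.card : ℝ) + d = Fintype.card V + 1 := by exact_mod_cast hcard
      linarith
    rw [hc] at h2
    simp only [Nat.cast_one, one_mul] at h1
    linarith)
  omega

lemma card_phi {V : Type} [Fintype V] {n : ℕ} (e : V ≃ Fin n) (P : ℕ → Prop) [DecidablePred P] :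
    (Finset.univ.filter fun v => P (e v).val).card = ((Finset.range n).filter P).card := by
  refine Finset.card_bij (fun v _ => (e v).val) ?_ ?_ ?_
  · intro v hv
    simp only [Finset.mem_filter, Finset.mem_univ, true_and] at hv
    simp [hv]
  · intro v _ w _ hvw
    exact e.injective (Fin.ext hvw)
  · intro j hj
    rw [Finset.mem_filter, Finset.mem_range] at hj
    exact ⟨e.symm ⟨j, hj.1⟩, by simp [hj.2], by simp⟩

lemma card_range_filter (n d s k : ℕ) (hs : s + k ≤ d + 1) (hn : d + 1 ≤ n) :
    ((Finset.range n).filter fun j => d + 1 ≤ j ∨ (s ≤ j ∧ j < s + k)).card + d + 1 = n + k := by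
  have : ((Finset.range n).filter fun j => d + 1 ≤ j ∨ (s ≤ j ∧ j < s + k))
      = Finset.Ico (d + 1) n ∪ Finset.Ico s (s + k) := by
    ext j
    simp only [Finset.mem_filter, Finset.mem_range, Finset.mem_union, Finset.mem_Ico]
    omega
  rw [this, Finset.card_union_of_disjoint, Nat.card_Ico, Nat.card_Ico]
  · omega
  · rw [Finset.disjoint_left]
    intro j
    rw [Finset.mem_Ico, Finset.mem_Ico]
    omega

lemma lower_Gndt {V : Type} [Fintype V] [DecidableEq V] (G : SimpleGraph V) (d t : ℕ)
    (hd : 2 ≤ d) (hn : d + 2 ≤ Fintype.card V) (ht : 2 ≤ t) (ht' : t ≤ d / 2 + 1)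
    (e : G ≃g Gndt (Fintype.card V) d t) :
    Fintype.card V ≤ cnt G ((Fintype.card V : ℝ) - d + 2) + d := by
  refine lower1 G (Finset.univ.filter fun v => d + 1 ≤ (e v).val ∨
    (t - 2 ≤ (e v).val ∧ (e v).val < t - 2 + 3)) d (e.symm ⟨t - 2, by omega⟩)
    (e.symm ⟨t, by omega⟩) ?_ ?_
  · intro v hv w hw hvw h1 h2
    simp only [Finset.mem_filter, Finset.mem_univ, true_and] at hv hw
    have hne : (e v).val ≠ (e w).val := fun h => hvw (e.injective (Fin.ext h))
    have h1' : ¬ ((e v).val = t - 2 ∧ (e w).val = t) := by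
      rintro ⟨a, b⟩
      exact h1 ⟨by rw [← e.symm_apply_apply v]; congr 1; exact Fin.ext a,
        by rw [← e.symm_apply_apply w]; congr 1; exact Fin.ext b⟩
    have h2' : ¬ ((e v).val = t ∧ (e w).val = t - 2) := by
      rintro ⟨a, b⟩
      exact h2 ⟨by rw [← e.symm_apply_apply v]; congr 1; exact Fin.ext a,
        by rw [← e.symm_apply_apply w]; congr 1; exact Fin.ext b⟩
    rw [← e.map_adj_iff]
    unfold Gndt
    rw [SimpleGraph.fromRel_adj]
    refine ⟨fun h => hne (congrArg _ h), ?_⟩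
    omega
  · have h1 := card_phi e.toEquiv (fun j => d + 1 ≤ j ∨ (t - 2 ≤ j ∧ j < t - 2 + 3))
    have h2 := card_range_filter (Fintype.card V) d (t - 2) 3 (by omega) (by omega)
    rw [← h1] at h2
    have h3 := h2
    simp only [RelIso.coe_fn_toEquiv] at h3
    omega

lemma lower_Gndra {V : Type} [Fintype V] [DecidableEq V] (G : SimpleGraph V) (d r a : ℕ)
    (hn : d + 2 ≤ Fintype.card V) (hr : 2 ≤ r) (hr' : r ≤ (d + 1) / 2) (ha : 1 ≤ a)
    (ha' : a ≤ Fintype.card V - d - 2)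
    (e : G ≃g Gndra (Fintype.card V) d r a) :
    Fintype.card V ≤ cnt G ((Fintype.card V : ℝ) - d + 2) + d := by
  refine lower2 G (Finset.univ.filter fun v => d + 1 ≤ (e v).val ∨
    (r - 1 ≤ (e v).val ∧ (e v).val < r - 1 + 2)) d ?_ ?_ ?_
  · intro v hv w hw hvw
    simp only [Finset.mem_filter, Finset.mem_univ, true_and] at hv hw
    have hne : (e v).val ≠ (e w).val := fun h => hvw (e.injective (Fin.ext h))
    rw [← e.map_adj_iff]
    unfold Gndra
    rw [SimpleGraph.fromRel_adj]
    refine ⟨fun h => hne (congrArg _ h), ?_⟩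
    generalize (e v).val = x at hv hne ⊢
    generalize (e w).val = y at hw hne ⊢
    rcases hv with hv | hv
    · rcases hw with hw | hw
      · exact Or.inl (Or.inr (Or.inl ⟨hv, hw⟩))
      · exact Or.inl (Or.inr (Or.inr (Or.inl ⟨hv, by omega⟩)))
    · rcases hw with hw | hw
      · exact Or.inr (Or.inr (Or.inr (Or.inl ⟨hw, by omega⟩)))
      · rcases Nat.lt_or_gt_of_ne hne with hlt | hlt
        · exact Or.inl (Or.inl ⟨by omega, by omega⟩)
        · exact Or.inr (Or.inl ⟨by omega, by omega⟩)
  · intro v hv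
    simp only [Finset.mem_filter, Finset.mem_univ, true_and] at hv
    have hlt := (e v).isLt
    by_cases hc : (e v).val = r - 1 ∨ (d + 1 ≤ (e v).val ∧ (e v).val ≤ d + a)
    · refine ⟨e.symm ⟨r - 2, by omega⟩, ?_, ?_⟩
      · simp only [Finset.mem_filter, Finset.mem_univ, true_and, RelIso.apply_symm_apply]
        omega
      · rw [← e.map_adj_iff, RelIso.apply_symm_apply]
        generalize e v = x at hv hlt hc ⊢
        unfold Gndra
        rw [SimpleGraph.fromRel_adj]
        constructor
        · intro h
          have := congrArg Fin.val h
          simp only at this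
          omega
        · rcases hc with hc | hc
          · exact Or.inr (Or.inl ⟨by simp only; omega, by omega⟩)
          · exact Or.inl (Or.inr (Or.inr (Or.inr (Or.inl ⟨hc.1, hc.2, rfl⟩))))
    · refine ⟨e.symm ⟨r + 1, by omega⟩, ?_, ?_⟩
      · simp only [Finset.mem_filter, Finset.mem_univ, true_and, RelIso.apply_symm_apply]
        omega
      · rw [← e.map_adj_iff, RelIso.apply_symm_apply]
        generalize e v = x at hv hlt hc ⊢
        unfold Gndra
        rw [SimpleGraph.fromRel_adj]
        constructor
        · intro h
          have := congrArg Fin.val h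
          simp only at this
          omega
        · rcases hv with hv | hv
          · exact Or.inl (Or.inr (Or.inr (Or.inr (Or.inr ⟨by omega, rfl⟩))))
          · exact Or.inl (Or.inl ⟨by simp only; omega, by simp only; omega⟩)
  · have h1 := card_phi e.toEquiv (fun j => d + 1 ≤ j ∨ (r - 1 ≤ j ∧ j < r - 1 + 2))
    have h2 := card_range_filter (Fintype.card V) d (r - 1) 2 (by omega) (by omega)
    rw [← h1] at h2
    have h3 := h2
    simp only [RelIso.coe_fn_toEquiv] at h3
    omega

/-! ### Building the isomorphisms -/

lemma exists_out {V : Type} [Fintype V] [DecidableEq V] {G : SimpleGraph V} {d : ℕ} {p : ℕ → V}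
    (h : Geo G d p) (hP : ¬ Nonempty (G ≃g SimpleGraph.pathGraph (d + 1))) :
    ∃ u, u ∉ pset d p := by
  by_contra hcon
  push Not at hcon
  apply hP
  let f : Fin (d + 1) → V := fun i => p i.val
  have hf : Function.Bijective f := by
    constructor
    · intro i j hij
      exact Fin.ext (h.inj _ _ (by omega) (by omega) hij)
    · intro v
      obtain ⟨j, hj, rfl⟩ := Finset.mem_image.1 (hcon v)
      exact ⟨⟨j, Finset.mem_range.1 hj⟩, rfl⟩
  refine ⟨RelIso.symm ⟨Equiv.ofBijective f hf, ?_⟩⟩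
  intro i j
  rw [SimpleGraph.pathGraph_adj]
  exact h.adj i.val j.val (by omega) (by omega)

lemma exists_enum {V : Type} (A : Finset V) :
    ∃ g : V → ℕ, Set.InjOn g A ∧ ∀ v ∈ A, g v < A.card := by
  classical
  refine ⟨fun v => if h : v ∈ A then (A.equivFin ⟨v, h⟩).val else 0, ?_, ?_⟩
  · intro v hv w hw hvw
    rw [Finset.mem_coe] at hv hw
    simp only [dif_pos hv, dif_pos hw] at hvw
    have := A.equivFin.injective (Fin.ext hvw)
    exact congrArg Subtype.val this
  · intro v hv
    simp only [dif_pos hv]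
    exact (A.equivFin ⟨v, hv⟩).isLt

lemma build_iso {V : Type} [Fintype V] [DecidableEq V] {G : SimpleGraph V} {d : ℕ} {p : ℕ → V}
    (h : Geo G d p) (A B : Finset V) (hAB : ∀ v, v ∈ pset d p ∨ v ∈ A ∨ v ∈ B)
    (hA : ∀ v ∈ A, v ∉ pset d p) (hB : ∀ v ∈ B, v ∉ pset d p) (hdis : ∀ v ∈ A, v ∉ B)
    (i : ℕ) (hi : i + 2 ≤ d)
    (hcl : ∀ u w, u ∉ pset d p → w ∉ pset d p → u ≠ w → G.Adj u w)
    (hNA : ∀ u ∈ A, ∀ j, j ≤ d → (G.Adj u (p j) ↔ i ≤ j ∧ j ≤ i + 2))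
    (hNB : ∀ u ∈ B, ∀ j, j ≤ d → (G.Adj u (p j) ↔ i + 1 ≤ j ∧ j ≤ i + 3)) :
    A.card + B.card + d + 1 = Fintype.card V ∧
    Nonempty (G ≃g Gndra (Fintype.card V) d (i + 2) A.card) := by
  classical
  have hcard : A.card + B.card + d + 1 = Fintype.card V := by
    have h1 : (Finset.univ : Finset V) = pset d p ∪ (A ∪ B) := by
      ext v
      simp only [Finset.mem_univ, Finset.mem_union, true_iff]
      exact hAB v
    rw [← Finset.card_univ, h1, Finset.card_union_of_disjoint, Finset.card_union_of_disjoint,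
      h.card]
    · omega
    · rw [Finset.disjoint_left]
      exact hdis
    · rw [Finset.disjoint_right]
      intro v hv
      rcases Finset.mem_union.1 hv with hv | hv
      · exact hA v hv
      · exact hB v hv
  refine ⟨hcard, ?_⟩
  obtain ⟨ga, ga1, ga2⟩ := exists_enum A
  obtain ⟨gb, gb1, gb2⟩ := exists_enum B
  have hex : ∀ v, v ∈ pset d p → ∃ j, j ≤ d ∧ p j = v := by
    intro v hv
    obtain ⟨j, hj, rfl⟩ := Finset.mem_image.1 hv
    exact ⟨j, by rw [Finset.mem_range] at hj; omega, rfl⟩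
  let f : V → ℕ := fun v =>
    if hv : v ∈ pset d p then (hex v hv).choose
    else if v ∈ A then d + 1 + ga v else d + 1 + A.card + gb v
  have hmemp : ∀ j, j ≤ d → p j ∈ pset d p := fun j hj =>
    Finset.mem_image.2 ⟨j, Finset.mem_range.2 (by omega), rfl⟩
  have fp : ∀ j, j ≤ d → f (p j) = j := by
    intro j hj
    have hm := hmemp j hj
    simp only [f, dif_pos hm]
    have := (hex _ hm).choose_spec
    exact h.inj _ _ this.1 hj this.2
  have fA : ∀ v ∈ A, f v = d + 1 + ga v := by
    intro v hv
    simp only [f, dif_neg (hA v hv), if_pos hv]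
  have fB : ∀ v ∈ B, f v = d + 1 + A.card + gb v := by
    intro v hv
    have : v ∉ A := fun h' => hdis v h' hv
    simp only [f, dif_neg (hB v hv), if_neg this]
  have cls : ∀ v, (∃ j, j ≤ d ∧ v = p j ∧ f v = j) ∨
      (v ∈ A ∧ d + 1 ≤ f v ∧ f v ≤ d + A.card) ∨
      (v ∈ B ∧ d + A.card + 1 ≤ f v ∧ f v < Fintype.card V) := by
    intro v
    rcases hAB v with hv | hv | hv
    · obtain ⟨j, hj, rfl⟩ := hex v hv
      exact Or.inl ⟨j, hj, rfl, fp j hj⟩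
    · have := fA v hv
      have := ga2 v hv
      exact Or.inr (Or.inl ⟨hv, by omega, by omega⟩)
    · have := fB v hv
      have := gb2 v hv
      exact Or.inr (Or.inr ⟨hv, by omega, by omega⟩)
  have flt : ∀ v, f v < Fintype.card V := by
    intro v
    rcases cls v with ⟨j, hj, _, hf⟩ | ⟨_, _, hf⟩ | ⟨_, _, hf⟩ <;> omega
  have finj : Function.Injective f := by
    intro v w hvw
    rcases cls v with ⟨j, hj, e1, hf⟩ | ⟨hv, hf, hf'⟩ | ⟨hv, hf, hf'⟩ <;>
    rcases cls w with ⟨k, hk, e2, hg⟩ | ⟨hw, hg, hg'⟩ | ⟨hw, hg, hg'⟩ <;>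
    first
    | omega
    | skip
    · rw [e1, e2]
      congr 1
      omega
    · rw [fA v hv, fA w hw] at hvw
      exact ga1 hv hw (by omega)
    · rw [fB v hv, fB w hw] at hvw
      exact gb1 hv hw (by omega)
  let F : V → Fin (Fintype.card V) := fun v => ⟨f v, flt v⟩
  have Fbij : Function.Bijective F := by
    rw [Fintype.bijective_iff_injective_and_card]
    refine ⟨fun v w hvw => finj (congrArg Fin.val hvw), by simp⟩
  refine ⟨⟨Equiv.ofBijective F Fbij, ?_⟩⟩
  intro v w
  rw [Equiv.ofBijective_apply, Equiv.ofBijective_apply]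
  unfold Gndra
  rw [SimpleGraph.fromRel_adj]
  have hne : F v ≠ F w ↔ f v ≠ f w := by
    rw [ne_eq, Fin.ext_iff]
  rw [hne]
  have hne' : f v ≠ f w ↔ v ≠ w := finj.ne_iff
  simp only [F]
  rcases cls v with ⟨j, hj, e1, hf⟩ | ⟨hv, hf, hf'⟩ | ⟨hv, hf, hf'⟩ <;>
  rcases cls w with ⟨k, hk, e2, hg⟩ | ⟨hw, hg, hg'⟩ | ⟨hw, hg, hg'⟩
  · rw [e1, e2, h.adj j k hj hk, fp j hj, fp k hk]
    omega
  · rw [e1, G.adj_comm, hNA w hw j hj, fp j hj]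
    omega
  · rw [e1, G.adj_comm, hNB w hw j hj, fp j hj]
    omega
  · rw [e2, hNA v hv k hk, fp k hk]
    omega
  · have := hcl v w (hA v hv) (hA w hw)
    rw [hne']
    exact ⟨fun h' => this h'.1, fun h' => ⟨h'.ne, by omega⟩⟩
  · have := hcl v w (hA v hv) (hB w hw)
    rw [hne']
    exact ⟨fun h' => this h'.1, fun h' => ⟨h'.ne, by omega⟩⟩
  · rw [e2, hNB v hv k hk, fp k hk]
    omega
  · have := hcl v w (hB v hv) (hA w hw)
    rw [hne']
    exact ⟨fun h' => this h'.1, fun h' => ⟨h'.ne, by omega⟩⟩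
  · have := hcl v w (hB v hv) (hB w hw)
    rw [hne']
    exact ⟨fun h' => this h'.1, fun h' => ⟨h'.ne, by omega⟩⟩

lemma Gndt_eq (n d t a : ℕ) (ht : 2 ≤ t) (ha : a + d + 1 = n) : Gndra n d t a = Gndt n d t := by
  ext v w
  unfold Gndra Gndt
  rw [SimpleGraph.fromRel_adj, SimpleGraph.fromRel_adj]
  have := v.isLt
  have := w.isLt
  refine and_congr Iff.rfl ?_
  omega

lemma pset_rev {V : Type} [DecidableEq V] (d : ℕ) (p : ℕ → V) :
    pset d (fun i => p (d - i)) = pset d p := by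
  ext v
  simp only [pset, Finset.mem_image, Finset.mem_range]
  constructor
  · rintro ⟨j, hj, rfl⟩
    exact ⟨d - j, by omega, rfl⟩
  · rintro ⟨j, hj, rfl⟩
    exact ⟨d - j, by omega, by congr 1; omega⟩

lemma forward {V : Type} [Fintype V] [DecidableEq V] {G : SimpleGraph V} {d : ℕ} {p : ℕ → V}
    (h : Geo G d p) (hd2 : 2 ≤ d) (u0 : V) (hu0 : u0 ∉ pset d p)
    (hc : Fintype.card V ≤ cnt G ((Fintype.card V : ℝ) - d + 2) + d) :
    ((∃ t : ℕ, 2 ≤ t ∧ t ≤ d / 2 + 1 ∧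
          Nonempty (G ≃g Gndt (Fintype.card V) d t)) ∨
       (∃ r a : ℕ, 2 ≤ r ∧ r ≤ (d + 1) / 2 ∧ 1 ≤ a ∧ a ≤ Fintype.card V - d - 2 ∧
          Nonempty (G ≃g Gndra (Fintype.card V) d r a))) := by
  classical
  have htri : ∀ u, ∃ i, u ∉ pset d p →
      (i + 2 ≤ d ∧ ∀ j, j ≤ d → (G.Adj u (p j) ↔ i ≤ j ∧ j ≤ i + 2)) := by
    intro u
    by_cases hu : u ∈ pset d p
    · exact ⟨0, fun h' => absurd hu h'⟩
    · obtain ⟨i, hi⟩ := triple h hd2 u hu hc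
      exact ⟨i, fun _ => hi⟩
  choose I hI using htri
  have hpair : ∀ u w, u ∉ pset d p → w ∉ pset d p → u ≠ w → G.Adj u w ∧ I w ≤ I u + 1 := by
    intro u w hu hw huw
    have h1 := hI u hu
    have h2 := hI w hw
    rcases le_total (I u) (I w) with hle | hle
    · exact pair_le h u w hu hw huw hc _ _ h1.1 h2.1 hle h1.2 h2.2
    · have := pair_le h w u hw hu huw.symm hc _ _ h2.1 h1.1 hle h2.2 h1.2
      exact ⟨this.1.symm, by omega⟩
  have hcl : ∀ u w, u ∉ pset d p → w ∉ pset d p → u ≠ w → G.Adj u w :=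
    fun u w hu hw huw => (hpair u w hu hw huw).1
  obtain ⟨um, hum, hmin⟩ := Finset.exists_min_image (pset d p)ᶜ I
    ⟨u0, Finset.mem_compl.2 hu0⟩
  rw [Finset.mem_compl] at hum
  set m := I um with hm
  have hmin' : ∀ u, u ∉ pset d p → m ≤ I u := fun u hu => hmin u (Finset.mem_compl.2 hu)
  have hmax' : ∀ u, u ∉ pset d p → I u ≤ m + 1 := by
    intro u hu
    by_cases he : um = u
    · rw [← he]; omega
    · exact (hpair um u hum hu he).2
  have hmd := (hI um hum).1
  rw [← hm] at hmd
  let A := (pset d p)ᶜ.filter fun u => I u = m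
  let B := (pset d p)ᶜ.filter fun u => I u = m + 1
  have mA : ∀ v, v ∈ A ↔ v ∉ pset d p ∧ I v = m := by
    intro v
    simp [A]
  have mB : ∀ v, v ∈ B ↔ v ∉ pset d p ∧ I v = m + 1 := by
    intro v
    simp [B]
  have hAB : ∀ v, v ∈ pset d p ∨ v ∈ A ∨ v ∈ B := by
    intro v
    by_cases hv : v ∈ pset d p
    · exact Or.inl hv
    · right
      rw [mA, mB]
      have := hmin' v hv
      have := hmax' v hv
      have : I v = m ∨ I v = m + 1 := by omega
      tauto
  have hA : ∀ v ∈ A, v ∉ pset d p := fun v hv => ((mA v).1 hv).1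
  have hB : ∀ v ∈ B, v ∉ pset d p := fun v hv => ((mB v).1 hv).1
  have hdis : ∀ v ∈ A, v ∉ B := by
    intro v hv hv'
    have h1 := ((mA v).1 hv).2
    have h2 := ((mB v).1 hv').2
    omega
  have hdis' : ∀ v ∈ B, v ∉ A := fun v hv hv' => hdis v hv' hv
  have hNA : ∀ u ∈ A, ∀ j, j ≤ d → (G.Adj u (p j) ↔ m ≤ j ∧ j ≤ m + 2) := by
    intro u hu j hj
    have h1 := (mA u).1 hu
    have h2 := (hI u h1.1).2 j hj
    rwa [h1.2] at h2
  have hNB : ∀ u ∈ B, ∀ j, j ≤ d → (G.Adj u (p j) ↔ m + 1 ≤ j ∧ j ≤ m + 3) := by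
    intro u hu j hj
    have h1 := (mB u).1 hu
    have h2 := (hI u h1.1).2 j hj
    rwa [h1.2] at h2
  have hAne : 1 ≤ A.card := Finset.card_pos.2 ⟨um, (mA um).2 ⟨hum, hm.symm⟩⟩
  have hrev := h.rev
  have hps := pset_rev d p
  obtain ⟨hcard, hiso⟩ := build_iso h A B hAB hA hB hdis m hmd hcl hNA hNB
  by_cases hBe : B = ∅
  · left
    have hB0 : B.card = 0 := by rw [hBe]; rfl
    by_cases hle : m + 2 ≤ d / 2 + 1
    · refine ⟨m + 2, by omega, hle, ?_⟩
      rwa [Gndt_eq _ _ _ _ (by omega) (by omega)] at hiso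
    · have := (build_iso hrev A ∅ (by
          intro v
          rw [hps]
          have := hAB v
          rwa [hBe] at this) (by rwa [hps]) (by simp) (by simp) (d - m - 2) (by omega)
          (by rwa [hps]) (by
            intro u hu j hj
            rw [hNA u hu (d - j) (by omega)]
            omega) (by simp)).2
      rw [Gndt_eq _ _ _ _ (by omega) (by omega)] at this
      exact ⟨d - m - 2 + 2, by omega, by omega, this⟩
  · right
    have hBne : B.Nonempty := Finset.nonempty_iff_ne_empty.2 hBe
    have hB1 : 1 ≤ B.card := Finset.card_pos.2 hBne
    obtain ⟨w, hw⟩ := hBne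
    have hmd3 : m + 3 ≤ d := by
      have h1 := (mB w).1 hw
      have h2 := (hI w h1.1).1
      omega
    by_cases hle : m + 2 ≤ (d + 1) / 2
    · exact ⟨m + 2, A.card, by omega, hle, hAne, by omega, hiso⟩
    · have := (build_iso hrev B A (by
          intro v
          rw [hps]
          have := hAB v
          tauto) (by rwa [hps]) (by rwa [hps]) hdis' (d - m - 3) (by omega)
          (by rwa [hps]) (by
            intro u hu j hj
            rw [hNB u hu (d - j) (by omega)]
            omega) (by
            intro u hu j hj
            rw [hNA u hu (d - j) (by omega)]
            omega)).2
      exact ⟨d - m - 3 + 2, B.card, by omega, by omega, hB1, by omega, this⟩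


theorem main_theorem_equality_characterization {V : Type} [Fintype V] [DecidableEq V]
    (G : SimpleGraph V) (hG : G.Connected) (d : ℕ) (hd : G.diam = d) (hd2 : 2 ≤ d)
    (hP : ¬ Nonempty (G ≃g SimpleGraph.pathGraph (d + 1))) :
    mIcc G ((Fintype.card V : ℝ) - d + 2) (Fintype.card V : ℝ) = Fintype.card V - d ↔
      ((∃ t : ℕ, 2 ≤ t ∧ t ≤ d / 2 + 1 ∧
          Nonempty (G ≃g Gndt (Fintype.card V) d t)) ∨
       (∃ r a : ℕ, 2 ≤ r ∧ r ≤ (d + 1) / 2 ∧ 1 ≤ a ∧ a ≤ Fintype.card V - d - 2 ∧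
          Nonempty (G ≃g Gndra (Fintype.card V) d r a))) := by

  obtain ⟨p, h⟩ := exists_geo G hG d hd
  obtain ⟨u, hu⟩ := exists_out h hP
  have hup := upper h hd2 u hu
  have hn : d + 2 ≤ Fintype.card V := by
    have := Finset.card_le_univ (insert u (pset d p))
    rw [Finset.card_insert_of_notMem hu, h.card] at this
    omega
  rw [mIcc_eq]
  constructor
  · intro hm
    exact forward h hd2 u hu (by omega)
  · intro hm
    have hlow : Fintype.card V ≤ cnt G ((Fintype.card V : ℝ) - d + 2) + d := by
      rcases hm with ⟨t, ht, ht', ⟨e⟩⟩ | ⟨r, a, hr, hr', ha, ha', ⟨e⟩⟩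
      · exact lower_Gndt G d t hd2 hn ht ht' e
      · exact lower_Gndra G d r a hn hr hr' ha ha' e
    omega
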